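/- arXiv:1211.4754 — 2 statements merged into one kernel-verified Lean document; each statement's English description precedes it below -/
import Mathlib

section
/- Let A = (A_1,…,A_q) be a system of endomorphisms of V, and suppose (S_u)_{u∈ℕ^q} is a family of endomorphisms of V such that for every differentiable curve τ ↦ A(τ) in End(V)^q with A(0) = A and every u ∈ ℕ^q one has d/dτ σ_u(A(τ))|_{τ=0} = Σ_{α=1}^q tr( (d/dτ A_α(τ)|_{τ=0}) ∘ S_{α♭(u)} ) (with S_{α♭(u)} = 0 when u_α = 0). Then S_u = T_u(A) for every u ∈ ℕ^q; that is, the generalized Newton transformation of A is unique. -/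
open scoped BigOperators

namespace GNTPaper

variable {p q : ℕ}

/-- The Newton polynomial `P_A(t) = det(1_V + tA)` of a system of endomorphisms
(represented as matrices w.r.t. an orthonormal basis), as a multivariate
polynomial in the variables `t_1, …, t_q`. -/
noncomputable def newtonMvPoly (A : Fin q → Matrix (Fin p) (Fin p) ℝ) :
    MvPolynomial (Fin q) ℝ :=
  Matrix.det (1 + ∑ α : Fin q, (MvPolynomial.X α : MvPolynomial (Fin q) ℝ) •
    (A α).map (fun x => (MvPolynomial.C x : MvPolynomial (Fin q) ℝ)))

/-- `σ_u(A)`: the coefficient of `t^u` in the Newton polynomial `P_A(t) = det(1 + tA)`. -/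
noncomputable def sigma (A : Fin q → Matrix (Fin p) (Fin p) ℝ) (u : Fin q → ℕ) : ℝ :=
  MvPolynomial.coeff (Finsupp.equivFunOnFinite.symm u) (newtonMvPoly A)

/-- A matrix `i ∈ I(q,s)` (a `q × s` matrix of zeros and ones with exactly one `1`
in each column) is encoded by the function `c : Fin s → Fin q` recording, for each
column `l`, the row `c l` containing its unique entry `1`.  `wt c α` is then the
weight `|i^α| = Σ_l i^α_l`, i.e. the number of columns whose `1` lies in row `α`. -/
def wt {s : ℕ} (c : Fin s → Fin q) (α : Fin q) : ℕ :=
  (Finset.univ.filter fun l => c l = α).card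

/-- The ordered composition `A^i = A_{c(1)} ⬝ A_{c(2)} ⬝ ⋯ ⬝ A_{c(s)}` associated to a
matrix `i ∈ I(q,s)` encoded by `c : Fin s → Fin q` (`A^i = 1` for `s = 0`). -/
noncomputable def prodSeq (A : Fin q → Matrix (Fin p) (Fin p) ℝ) {s : ℕ}
    (c : Fin s → Fin q) : Matrix (Fin p) (Fin p) ℝ :=
  (List.ofFn fun l => A (c l)).prod

/-- `σ_{u - |i|}(A)`, where by convention it is `0` whenever `u - |i|` has a
negative entry. -/
noncomputable def sigmaSub (A : Fin q → Matrix (Fin p) (Fin p) ℝ) (u : Fin q → ℕ)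
    {s : ℕ} (c : Fin s → Fin q) : ℝ :=
  if ∀ α, wt c α ≤ u α then sigma A (fun α => u α - wt c α) else 0

/-- The generalized Newton transformation
`T_u(A) = Σ_{s=0}^{|u|} Σ_{i ∈ I(q,s)} (-1)^{‖i‖} σ_{u-|i|}(A) A^i`. -/
noncomputable def gnt (A : Fin q → Matrix (Fin p) (Fin p) ℝ) (u : Fin q → ℕ) :
    Matrix (Fin p) (Fin p) ℝ :=
  ∑ s ∈ Finset.range ((∑ α, u α) + 1),
    (-1 : ℝ) ^ s • ∑ c : Fin s → Fin q, sigmaSub A u c • prodSeq A c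

/-- `T_{α♭(u)}(A)`, with the convention that it is `0` when `u α = 0`. -/
noncomputable def gntFlat (A : Fin q → Matrix (Fin p) (Fin p) ℝ) (α : Fin q)
    (u : Fin q → ℕ) : Matrix (Fin p) (Fin p) ℝ :=
  if u α = 0 then 0 else gnt A (Function.update u α (u α - 1))

/-- `σ_{α♭(u)}(A)`, with the convention that it is `0` when `u α = 0`. -/
noncomputable def sigmaFlat (A : Fin q → Matrix (Fin p) (Fin p) ℝ) (α : Fin q)
    (u : Fin q → ℕ) : ℝ :=
  if u α = 0 then 0 else sigma A (Function.update u α (u α - 1))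

/-- The generalized Kronecker symbol `δ^{i_1…i_r}_{j_1…j_r}`, equal to `+1` (resp. `-1`)
if the `i`'s are distinct and the `j`'s are an even (resp. odd) permutation of the `i`'s,
and `0` otherwise; given by the classical determinant formula `det(δ_{i_k j_l})_{k,l}`. -/
noncomputable def gkron {n r : ℕ} (i j : Fin r → Fin n) : ℝ :=
  Matrix.det (Matrix.of fun k l : Fin r => if i k = j l then (1 : ℝ) else 0)

/-- For `k < 2m`, the index `⌊k/2⌋ < m`; used to pair consecutive indices. -/
def halfIdx {m : ℕ} (k : Fin (2 * m)) : Fin m :=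
  ⟨(k : ℕ) / 2, Nat.div_lt_of_lt_mul k.isLt⟩

/-- The scalar `S_r(A)` (for `r = 2m` even) from Reilly's construction. -/
noncomputable def Sr (A : Fin q → Matrix (Fin p) (Fin p) ℝ) (m : ℕ) : ℝ :=
  (1 / ((2 * m).factorial : ℝ)) *
    ∑ iv : Fin (2 * m) → Fin p, ∑ jv : Fin (2 * m) → Fin p,
      gkron iv jv * ∑ a : Fin m → Fin q, ∏ k : Fin (2 * m), A (a (halfIdx k)) (iv k) (jv k)

/-- The Reilly operator `T_r(A)` (for `r = 2m` even). -/
noncomputable def TrReilly (A : Fin q → Matrix (Fin p) (Fin p) ℝ) (m : ℕ) :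
    Matrix (Fin p) (Fin p) ℝ :=
  Matrix.of fun i j => (1 / ((2 * m).factorial : ℝ)) *
    ∑ iv : Fin (2 * m) → Fin p, ∑ jv : Fin (2 * m) → Fin p,
      gkron (Fin.snoc iv i) (Fin.snoc jv j) *
        ∑ a : Fin m → Fin q, ∏ k : Fin (2 * m), A (a (halfIdx k)) (iv k) (jv k)

/-- The Reilly operator `T_{r+1}^α(A)` (for `r = 2m` even). -/
noncomputable def Tr1Reilly (A : Fin q → Matrix (Fin p) (Fin p) ℝ) (m : ℕ) (α : Fin q) :
    Matrix (Fin p) (Fin p) ℝ :=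
  Matrix.of fun i j => (1 / ((2 * m).factorial : ℝ)) *
    ∑ iv : Fin (2 * m + 1) → Fin p, ∑ jv : Fin (2 * m + 1) → Fin p,
      gkron (Fin.snoc iv i) (Fin.snoc jv j) *
        (A α (iv (Fin.last (2 * m))) (jv (Fin.last (2 * m))) *
          ∑ a : Fin m → Fin q, ∏ k : Fin (2 * m),
            A (a (halfIdx k)) (iv k.castSucc) (jv k.castSucc))

/-- The (finite) set of multi-indices `u ∈ 2ℕ(q)` with `|u| = r` (all entries even,
total length `r`). -/
noncomputable def evenIdx (q r : ℕ) : Finset (Fin q → ℕ) :=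
  (Fintype.piFinset fun _ : Fin q => Finset.range (r + 1)).filter
    fun u => (∀ α, Even (u α)) ∧ ∑ α, u α = r

/-- The matrix `1 + tA` with polynomial entries whose determinant is the Newton polynomial. -/
noncomputable def newtonMatrix (A : Fin q → Matrix (Fin p) (Fin p) ℝ) :
    Matrix (Fin p) (Fin p) (MvPolynomial (Fin q) ℝ) :=
  1 + ∑ α : Fin q, (MvPolynomial.X α : MvPolynomial (Fin q) ℝ) •
    (A α).map (fun x => (MvPolynomial.C x : MvPolynomial (Fin q) ℝ))

/-- The coefficient of `t^u` in the adjugate of `1 + tA`. -/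
noncomputable def adjCoeff (A : Fin q → Matrix (Fin p) (Fin p) ℝ) (u : Fin q → ℕ) :
    Matrix (Fin p) (Fin p) ℝ :=
  (newtonMatrix A).adjugate.map (MvPolynomial.coeff (Finsupp.equivFunOnFinite.symm u))

theorem coeff_X_mul_equivFunOnFinite (α : Fin q) (f : MvPolynomial (Fin q) ℝ) (u : Fin q → ℕ) :
    MvPolynomial.coeff (Finsupp.equivFunOnFinite.symm u) (MvPolynomial.X α * f) =
      if u α = 0 then 0 else
        MvPolynomial.coeff
          (Finsupp.equivFunOnFinite.symm (Function.update u α (u α - 1))) f := by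
  rw [MvPolynomial.coeff_X_mul']
  by_cases h : u α = 0
  · simp [h]
  · simp only [Finsupp.mem_support_iff, Finsupp.equivFunOnFinite_symm_apply_apply, ne_eq, h,
      not_false_eq_true, if_true, if_false]
    congr 1
    ext β
    by_cases hβ : β = α
    · subst hβ; simp
    · simp [hβ]

theorem adjCoeff_add_sum (A : Fin q → Matrix (Fin p) (Fin p) ℝ) (u : Fin q → ℕ) :
    adjCoeff A u + ∑ α, A α *
      (if u α = 0 then 0 else adjCoeff A (Function.update u α (u α - 1))) =
      sigma A u • (1 : Matrix (Fin p) (Fin p) ℝ) := by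
  have h : newtonMatrix A * (newtonMatrix A).adjugate = newtonMvPoly A • 1 :=
    Matrix.mul_adjugate _
  have hM : newtonMatrix A * (newtonMatrix A).adjugate = (newtonMatrix A).adjugate +
      ∑ α, (MvPolynomial.X α : MvPolynomial (Fin q) ℝ) •
        ((A α).map (fun x => (MvPolynomial.C x : MvPolynomial (Fin q) ℝ)) *
          (newtonMatrix A).adjugate) := by
    conv_lhs => enter [1]; rw [newtonMatrix]
    simp [add_mul, Finset.sum_mul]
  rw [hM] at h
  ext i j
  have hij := congrArg (MvPolynomial.coeff (Finsupp.equivFunOnFinite.symm u)) (congrFun₂ h i j)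
  simp only [Matrix.add_apply, Matrix.sum_apply, Matrix.smul_apply, smul_eq_mul,
    MvPolynomial.coeff_add, MvPolynomial.coeff_sum, coeff_X_mul_equivFunOnFinite,
    Matrix.mul_apply, Matrix.map_apply, MvPolynomial.coeff_C_mul] at hij
  simp only [Matrix.add_apply, Matrix.sum_apply, Matrix.smul_apply, smul_eq_mul, adjCoeff,
    Matrix.mul_apply, Matrix.map_apply]
  have hr : MvPolynomial.coeff (Finsupp.equivFunOnFinite.symm u)
      (newtonMvPoly A * (1 : Matrix (Fin p) (Fin p) (MvPolynomial (Fin q) ℝ)) i j) =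
      sigma A u * (1 : Matrix (Fin p) (Fin p) ℝ) i j := by
    by_cases hij : i = j <;> simp [hij, sigma, Matrix.one_apply]
  rw [← hr, ← hij]
  congr 1
  refine Finset.sum_congr rfl fun α _ => ?_
  split_ifs <;> simp

theorem wt_cons {s : ℕ} (α : Fin q) (c : Fin s → Fin q) (β : Fin q) :
    wt (Fin.cons α c : Fin (s + 1) → Fin q) β = (if α = β then 1 else 0) + wt c β := by
  rw [wt, wt, Finset.card_filter, Finset.card_filter, Fin.sum_univ_succ]
  simp only [Fin.cons_zero, Fin.cons_succ]

theorem sigmaSub_cons (A : Fin q → Matrix (Fin p) (Fin p) ℝ) (u : Fin q → ℕ) {s : ℕ}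
    (α : Fin q) (c : Fin s → Fin q) :
    sigmaSub A u (Fin.cons α c : Fin (s + 1) → Fin q) =
      if u α = 0 then 0 else sigmaSub A (Function.update u α (u α - 1)) c := by
  by_cases h : u α = 0
  · rw [if_pos h, sigmaSub, if_neg]
    intro H
    have := H α
    simp [wt_cons, h] at this
  · rw [if_neg h, sigmaSub, sigmaSub]
    have hiff (β : Fin q) : wt (Fin.cons α c : Fin (s + 1) → Fin q) β ≤ u β ↔
        wt c β ≤ Function.update u α (u α - 1) β := by
      rw [wt_cons]
      by_cases hβ : β = α
      · subst hβ; simp; omega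
      · simp [hβ, Ne.symm hβ]
    have hsub (β : Fin q) : u β - wt (Fin.cons α c : Fin (s + 1) → Fin q) β =
        Function.update u α (u α - 1) β - wt c β := by
      rw [wt_cons]
      by_cases hβ : β = α
      · subst hβ; simp; omega
      · simp [hβ, Ne.symm hβ]
    simp only [hiff, hsub]

theorem prodSeq_cons (A : Fin q → Matrix (Fin p) (Fin p) ℝ) {s : ℕ}
    (α : Fin q) (c : Fin s → Fin q) :
    prodSeq A (Fin.cons α c : Fin (s + 1) → Fin q) = A α * prodSeq A c := by
  simp [prodSeq, List.ofFn_succ]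

theorem sum_update_pred (u : Fin q → ℕ) {α : Fin q} (h : u α ≠ 0) :
    ∑ β, Function.update u α (u α - 1) β + 1 = ∑ β, u β := by
  rw [Finset.sum_update_of_mem (Finset.mem_univ α),
    ← Finset.add_sum_erase _ _ (Finset.mem_univ α), Finset.sdiff_singleton_eq_erase]
  omega

theorem gnt_add_sum (A : Fin q → Matrix (Fin p) (Fin p) ℝ) (u : Fin q → ℕ) :
    gnt A u + ∑ α, A α *
      (if u α = 0 then 0 else gnt A (Function.update u α (u α - 1))) =
      sigma A u • (1 : Matrix (Fin p) (Fin p) ℝ) := by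
  have hsucc (s : ℕ) : ∑ c : Fin (s + 1) → Fin q, sigmaSub A u c • prodSeq A c =
      ∑ α, A α * (if u α = 0 then 0 else
        ∑ c : Fin s → Fin q, sigmaSub A (Function.update u α (u α - 1)) c • prodSeq A c) := by
    rw [← (Fin.consEquiv fun _ : Fin (s + 1) => Fin q).sum_comp, Fintype.sum_prod_type]
    refine Finset.sum_congr rfl fun α _ => ?_
    change ∑ c : Fin s → Fin q, sigmaSub A u (Fin.cons α c : Fin (s + 1) → Fin q) •
      prodSeq A (Fin.cons α c : Fin (s + 1) → Fin q) = _
    simp only [sigmaSub_cons, prodSeq_cons]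
    split_ifs <;> simp [Finset.mul_sum]
  have hsum : ∑ α, A α * (if u α = 0 then 0 else gnt A (Function.update u α (u α - 1))) =
      ∑ s ∈ Finset.range (∑ α, u α), (-1 : ℝ) ^ s •
        ∑ c : Fin (s + 1) → Fin q, sigmaSub A u c • prodSeq A c := by
    have hs (s : ℕ) : (-1 : ℝ) ^ s •
        ∑ c : Fin (s + 1) → Fin q, sigmaSub A u c • prodSeq A c =
        ∑ α, (-1 : ℝ) ^ s • (A α * (if u α = 0 then 0 else
          ∑ c : Fin s → Fin q,
            sigmaSub A (Function.update u α (u α - 1)) c • prodSeq A c)) := by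
      rw [hsucc, Finset.smul_sum]
    rw [Finset.sum_congr rfl fun s _ => hs s]
    rw [Finset.sum_comm]
    refine Finset.sum_congr rfl fun α _ => ?_
    split_ifs with h
    · simp
    · rw [gnt, sum_update_pred u h, Finset.mul_sum]
      simp
  have hzero : ∑ c : Fin 0 → Fin q, sigmaSub A u c • prodSeq A c = sigma A u • 1 := by
    simp [sigmaSub, prodSeq, wt]
  rw [hsum, gnt, Finset.sum_range_succ', hzero]
  simp [pow_succ]

theorem adjCoeff_eq_gnt (A : Fin q → Matrix (Fin p) (Fin p) ℝ) (u : Fin q → ℕ) :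
    adjCoeff A u = gnt A u := by
  induction hn : ∑ α, u α using Nat.strong_induction_on generalizing u with
  | _ n ih =>
    have h := (adjCoeff_add_sum A u).trans (gnt_add_sum A u).symm
    have hsum : ∑ α, A α *
        (if u α = 0 then 0 else adjCoeff A (Function.update u α (u α - 1))) =
        ∑ α, A α * (if u α = 0 then 0 else gnt A (Function.update u α (u α - 1))) := by
      refine Finset.sum_congr rfl fun α _ => ?_
      split_ifs with hα
      · rfl
      · rw [ih _ (by have := sum_update_pred u hα; omega) _ rfl]
    rw [hsum] at h
    exact add_right_cancel h

theorem det_add_single {n R : Type*} [Fintype n] [DecidableEq n] [CommRing R]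
    (M : Matrix n n R) (i j : n) (c : R) :
    (M + Matrix.single j i c).det = M.det + c * M.adjugate i j := by
  have h : M + Matrix.single j i c = M.updateRow j (M j + c • Pi.single i 1) := by
    ext k l
    by_cases hk : k = j
    · subst hk
      simp [Matrix.single_apply, Pi.single_apply, eq_comm]
    · simp [hk, Ne.symm hk]
  rw [h, Matrix.det_updateRow_add, Matrix.det_updateRow_smul, Matrix.adjugate_apply,
    Matrix.updateRow_eq_self]

theorem newtonMatrix_add_single (A : Fin q → Matrix (Fin p) (Fin p) ℝ) (α : Fin q)
    (i j : Fin p) (τ : ℝ) :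
    newtonMatrix (A + Pi.single α (Matrix.single j i τ)) =
      newtonMatrix A + Matrix.single j i (MvPolynomial.X α * MvPolynomial.C τ) := by
  have h (β : Fin q) : (MvPolynomial.X β : MvPolynomial (Fin q) ℝ) •
      ((A + Pi.single α (Matrix.single j i τ) : Fin q → Matrix (Fin p) (Fin p) ℝ) β).map
        (fun x => (MvPolynomial.C x : MvPolynomial (Fin q) ℝ)) =
      (MvPolynomial.X β : MvPolynomial (Fin q) ℝ) •
        (A β).map (fun x => (MvPolynomial.C x : MvPolynomial (Fin q) ℝ)) +
      if β = α then Matrix.single j i (MvPolynomial.X α * MvPolynomial.C τ) else 0 := by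
    ext1 k l
    by_cases hβ : β = α
    · subst hβ
      by_cases hkl : j = k ∧ i = l <;> simp [hkl, mul_add]
    · simp [hβ]
  simp only [newtonMatrix, h, Finset.sum_add_distrib, Finset.sum_ite_eq', Finset.mem_univ,
    if_true, add_assoc]

theorem sigma_add_single (A : Fin q → Matrix (Fin p) (Fin p) ℝ) (α : Fin q)
    (i j : Fin p) (τ : ℝ) (u : Fin q → ℕ) :
    sigma (A + Pi.single α (Matrix.single j i τ)) (Function.update u α (u α + 1)) =
      sigma A (Function.update u α (u α + 1)) + τ * gnt A u i j := by
  have h : newtonMvPoly (A + Pi.single α (Matrix.single j i τ)) = newtonMvPoly A +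
      MvPolynomial.X α * (MvPolynomial.C τ * (newtonMatrix A).adjugate i j) := by
    rw [← mul_assoc]
    exact (congrArg Matrix.det (newtonMatrix_add_single A α i j τ)).trans (det_add_single _ _ _ _)
  rw [sigma, h, MvPolynomial.coeff_add, coeff_X_mul_equivFunOnFinite, ← adjCoeff_eq_gnt]
  simp [adjCoeff, sigma]

theorem statement_1 (hq : 1 ≤ q) (A : Fin q → Matrix (Fin p) (Fin p) ℝ)
    (S : (Fin q → ℕ) → Matrix (Fin p) (Fin p) ℝ)
    (hS : ∀ (𝓐 : ℝ → Fin q → Matrix (Fin p) (Fin p) ℝ)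
      (𝓐' : Fin q → Matrix (Fin p) (Fin p) ℝ),
      𝓐 0 = A → (∀ α i j, HasDerivAt (fun τ => 𝓐 τ α i j) (𝓐' α i j) 0) →
      ∀ u : Fin q → ℕ,
        HasDerivAt (fun τ => sigma (𝓐 τ) u)
          (∑ α, Matrix.trace (𝓐' α *
            (if u α = 0 then 0 else S (Function.update u α (u α - 1))))) 0) :
    ∀ u : Fin q → ℕ, S u = gnt A u := by
  intro u
  ext i j
  let α : Fin q := ⟨0, hq⟩
  have hcurve := hS (fun τ => A + Pi.single α (Matrix.single j i τ))
    (Pi.single α (Matrix.single j i 1)) (by simp) (fun β k l => by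
      by_cases hβ : β = α
      · subst hβ
        by_cases hkl : j = k ∧ i = l
        · simpa [Matrix.single_apply, hkl] using (hasDerivAt_id (0 : ℝ)).const_add (A α k l)
        · simpa [Matrix.single_apply, hkl] using hasDerivAt_const (0 : ℝ) (A α k l)
      · simpa [hβ] using hasDerivAt_const (0 : ℝ) (A β k l))
    (Function.update u α (u α + 1))
  simp only [sigma_add_single] at hcurve
  have hgnt : HasDerivAt (fun τ : ℝ => sigma A (Function.update u α (u α + 1)) + τ * gnt A u i j)
      (gnt A u i j) 0 := by
    simpa using ((hasDerivAt_id (0 : ℝ)).mul_const (gnt A u i j)).const_add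
      (sigma A (Function.update u α (u α + 1)))
  have heq := hcurve.unique hgnt
  rw [Finset.sum_eq_single α (fun β _ hβ => by simp [hβ]) (by simp)] at heq
  simpa [Matrix.trace_single_mul] using heq

end GNTPaper
end

section
/- Let A = (A_1,…,A_q) be a system of endomorphisms of V, let r ≥ 0 and let α_1,…,α_r ∈ {1,…,q} be any indices. Set u = α_1♯⋯α_r♯(0,…,0), the multi-index whose α-th entry counts the occurrences of α among α_1,…,α_r. Then σ_u(A) = (1/u!) Σ_{i_1,…,i_r,j_1,…,j_r} δ^{i_1…i_r}_{j_1…j_r} (A_{α_1})_{i_1j_1}⋯(A_{α_r})_{i_rj_r}, where u! = u_1!⋯u_q! and the indices i_k, j_k range over {1,…,p}. -/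
open scoped BigOperators

namespace GNTPaper

variable {p q : ℕ}

section Minors

variable {R n κ ι : Type*} [CommRing R]

theorem det_one_add_eq_sum_minors [Fintype n] [DecidableEq n]
    (M : Matrix n n R) :
    (1 + M).det = ∑ s : Finset n, (M.submatrix (Subtype.val : s → n) Subtype.val).det := by
  rw [add_comm]
  simp only [← Matrix.det_piecewise_one_eq_submatrix_det]
  exact (Matrix.detRowAlternating : (n → R) [⋀^n]→ₗ[R] R).map_add_univ M (1 : Matrix n n R)

theorem card_filter_image_eq [Fintype n] [DecidableEq n] [Fintype κ] [DecidableEq κ]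
    (s : Finset n) (hs : s.card = Fintype.card κ) :
    (Finset.univ.filter fun i : κ → n => Finset.univ.image i = s).card
      = (Fintype.card κ).factorial := by
  have e : κ ≃ s := Fintype.equivOfCardEq (by simp [hs])
  rw [← Fintype.card_equiv e, ← Finset.card_univ]
  symm
  refine Finset.card_bij (fun f _ k => (f k : n)) ?_ ?_ ?_
  · intro f _
    simp only [Finset.mem_filter, Finset.mem_univ, true_and]
    ext x
    simp only [Finset.mem_image, Finset.mem_univ, true_and]
    exact ⟨by rintro ⟨k, rfl⟩; exact (f k).2, fun hx => ⟨f.symm ⟨x, hx⟩, by simp⟩⟩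
  · intro f _ g _ h
    ext k
    exact congrFun h k
  · intro i hi
    simp only [Finset.mem_filter, Finset.mem_univ, true_and] at hi
    have hmem : ∀ k, i k ∈ s := fun k => hi ▸ Finset.mem_image_of_mem i (Finset.mem_univ k)
    have hsurj : Function.Surjective fun k => (⟨i k, hmem k⟩ : s) := by
      rintro ⟨x, hx⟩
      rw [← hi] at hx
      obtain ⟨k, -, hk⟩ := Finset.mem_image.1 hx
      exact ⟨k, Subtype.ext hk⟩
    exact ⟨Equiv.ofBijective _ ((Fintype.bijective_iff_surjective_and_card _).2
      ⟨hsurj, by simp [hs]⟩), Finset.mem_univ _, rfl⟩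

theorem det_submatrix_eq_of_image_eq [DecidableEq n] [Fintype κ] [DecidableEq κ]
    (M : Matrix n n R) (s : Finset n)
    (hs : s.card = Fintype.card κ) (i : κ → n) (hi : Finset.univ.image i = s) :
    (M.submatrix i i).det = (M.submatrix (Subtype.val : s → n) Subtype.val).det := by
  subst hi
  have hsurj : Function.Surjective fun k =>
      (⟨i k, Finset.mem_image_of_mem i (Finset.mem_univ k)⟩ : Finset.univ.image i) := by
    rintro ⟨x, hx⟩
    obtain ⟨k, -, hk⟩ := Finset.mem_image.1 hx
    exact ⟨k, Subtype.ext hk⟩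
  have hbij := (Fintype.bijective_iff_surjective_and_card _).2
    ⟨hsurj, by rw [Fintype.card_coe, hs]⟩
  rw [← Matrix.det_submatrix_equiv_self (Equiv.ofBijective _ hbij)]
  rfl

variable (κ) in
theorem sum_det_submatrix_eq_factorial_mul [Fintype n] [DecidableEq n] [Fintype κ] [DecidableEq κ]
    (M : Matrix n n R) :
    ∑ i : κ → n, (M.submatrix i i).det
      = (Fintype.card κ).factorial * ∑ s ∈ Finset.univ.powersetCard (Fintype.card κ),
        (M.submatrix (Subtype.val : s → n) Subtype.val).det := by
  have hinj : ∑ i : κ → n, (M.submatrix i i).det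
      = ∑ i : κ → n with Function.Injective i, (M.submatrix i i).det := by
    symm
    refine Finset.sum_filter_of_ne fun i _ h => ?_
    by_contra hi
    simp only [Function.Injective, not_forall] at hi
    obtain ⟨a, b, hab, hne⟩ := hi
    exact h (Matrix.det_zero_of_row_eq hne (by ext l; simp [hab]))
  rw [hinj, ← Finset.sum_fiberwise_of_maps_to (g := fun i => Finset.univ.image i)
    (t := Finset.univ.powersetCard (Fintype.card κ)), Finset.mul_sum]
  · refine Finset.sum_congr rfl fun s hs => ?_
    have hs' := (Finset.mem_powersetCard.1 hs).2
    rw [Finset.filter_filter, ← card_filter_image_eq s hs', ← nsmul_eq_mul]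
    have hset : (Finset.univ.filter fun i : κ → n =>
        Function.Injective i ∧ Finset.univ.image i = s)
        = Finset.univ.filter fun i : κ → n => Finset.univ.image i = s := by
      refine Finset.filter_congr fun i _ => ⟨fun h => h.2, fun h => ⟨?_, h⟩⟩
      rw [← h, ← Finset.card_univ] at hs'
      simpa using Finset.card_image_iff.1 hs'
    rw [hset]
    exact Finset.sum_eq_card_nsmul fun i hi =>
      det_submatrix_eq_of_image_eq M s hs' i (Finset.mem_filter.1 hi).2
  · intro i hi
    simp only [Finset.mem_filter, Finset.mem_univ, true_and] at hi
    simp [Finset.mem_powersetCard, Finset.card_image_of_injective _ hi]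

theorem coeff_det_submatrix_linear_comb [Fintype κ] [DecidableEq κ] [Fintype ι] [DecidableEq ι]
    (A : ι → Matrix n n R) (i : κ → n) (u : ι →₀ ℕ) :
    MvPolynomial.coeff u
        (((∑ α, (MvPolynomial.X α : MvPolynomial ι R) •
          (A α).map (fun x => (MvPolynomial.C x : MvPolynomial ι R))).submatrix i i).det)
      = ∑ c : κ → ι, if ∑ k, Finsupp.single (c k) 1 = u then
          (Matrix.of fun k l => A (c k) (i k) (i l)).det else 0 := by
  have hrow : ((∑ α, (MvPolynomial.X α : MvPolynomial ι R) •
        (A α).map (fun x => (MvPolynomial.C x : MvPolynomial ι R))).submatrix i i)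
      = fun k => ∑ α, (MvPolynomial.X α : MvPolynomial ι R) •
        fun l => (MvPolynomial.C (A α (i k) (i l)) : MvPolynomial ι R) := by
    funext k l
    simp [Matrix.sum_apply]
  have hdet : ((∑ α, (MvPolynomial.X α : MvPolynomial ι R) •
        (A α).map (fun x => (MvPolynomial.C x : MvPolynomial ι R))).submatrix i i).det
      = ∑ c : κ → ι, MvPolynomial.monomial (∑ k, Finsupp.single (c k) 1)
          (Matrix.of fun k l => A (c k) (i k) (i l)).det := by
    rw [hrow]
    refine ((Matrix.detRowAlternating :
      (κ → MvPolynomial ι R) [⋀^κ]→ₗ[MvPolynomial ι R] MvPolynomial ι R).toMultilinearMap.map_sum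
        (fun k α => (MvPolynomial.X α : MvPolynomial ι R) •
          fun l => (MvPolynomial.C (A α (i k) (i l)) : MvPolynomial ι R))).trans
        (Finset.sum_congr rfl fun c _ => ?_)
    rw [MultilinearMap.map_smul_univ]
    have hC : (Matrix.detRowAlternating :
        (κ → MvPolynomial ι R) [⋀^κ]→ₗ[MvPolynomial ι R] MvPolynomial ι R).toMultilinearMap
          (fun k l => (MvPolynomial.C (A (c k) (i k) (i l)) : MvPolynomial ι R))
        = MvPolynomial.C (Matrix.of fun k l => A (c k) (i k) (i l)).det :=
      (RingHom.map_det MvPolynomial.C (Matrix.of fun k l => A (c k) (i k) (i l))).symm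
    rw [hC, smul_eq_mul, mul_comm, MvPolynomial.monomial_sum_index]
    rfl
  rw [hdet, MvPolynomial.coeff_sum]
  simp only [MvPolynomial.coeff_monomial]

theorem coeff_det_submatrix_linear_comb_eq_zero [Fintype κ] [DecidableEq κ]
    [Fintype ι] [DecidableEq ι]
    (A : ι → Matrix n n R) (i : κ → n) (u : ι →₀ ℕ)
    (hu : Fintype.card κ ≠ u.degree) :
    MvPolynomial.coeff u
        (((∑ α, (MvPolynomial.X α : MvPolynomial ι R) •
          (A α).map (fun x => (MvPolynomial.C x : MvPolynomial ι R))).submatrix i i).det) = 0 := by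
  rw [coeff_det_submatrix_linear_comb]
  refine Finset.sum_eq_zero fun c _ => if_neg ?_
  rintro rfl
  exact hu (by simp)

theorem factorial_mul_coeff_det_one_add [Fintype n] [DecidableEq n] [Fintype κ] [DecidableEq κ]
    [Fintype ι] [DecidableEq ι]
    (A : ι → Matrix n n R) (u : ι →₀ ℕ)
    (hu : u.degree = Fintype.card κ) :
    (Fintype.card κ).factorial * MvPolynomial.coeff u
        ((1 + ∑ α, (MvPolynomial.X α : MvPolynomial ι R) •
          (A α).map (fun x => (MvPolynomial.C x : MvPolynomial ι R))).det)
      = ∑ c : κ → ι with ∑ k, Finsupp.single (c k) 1 = u,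
          ∑ i : κ → n, (Matrix.of fun k l => A (c k) (i k) (i l)).det := by
  have hminors : MvPolynomial.coeff u
        ((1 + ∑ α, (MvPolynomial.X α : MvPolynomial ι R) •
          (A α).map (fun x => (MvPolynomial.C x : MvPolynomial ι R))).det)
      = MvPolynomial.coeff u (∑ s ∈ Finset.univ.powersetCard (Fintype.card κ),
        ((∑ α, (MvPolynomial.X α : MvPolynomial ι R) •
          (A α).map (fun x => (MvPolynomial.C x : MvPolynomial ι R))).submatrix
            (Subtype.val : s → n) Subtype.val).det) := by
    rw [det_one_add_eq_sum_minors, MvPolynomial.coeff_sum, MvPolynomial.coeff_sum]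
    symm
    refine Finset.sum_subset (Finset.subset_univ _) fun s _ hs => ?_
    refine coeff_det_submatrix_linear_comb_eq_zero A _ u fun h => hs ?_
    simpa [Finset.mem_powersetCard, hu] using h
  rw [hminors, ← MvPolynomial.coeff_C_mul, map_natCast,
    ← sum_det_submatrix_eq_factorial_mul κ, MvPolynomial.coeff_sum]
  simp only [coeff_det_submatrix_linear_comb]
  rw [Finset.sum_comm, Finset.sum_filter]
  refine Finset.sum_congr rfl fun c _ => ?_
  split_ifs <;> simp

theorem sum_det_comp_perm [Fintype n] [Fintype κ] [DecidableEq κ]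
    (A : ι → Matrix n n R) (c : κ → ι) (σ : Equiv.Perm κ) :
    ∑ i : κ → n, (Matrix.of fun k l => A (c (σ k)) (i k) (i l)).det
      = ∑ i : κ → n, (Matrix.of fun k l => A (c k) (i k) (i l)).det := by
  refine Fintype.sum_equiv (σ.arrowCongr (Equiv.refl n)) _ _ fun i => ?_
  rw [← Matrix.det_submatrix_equiv_self σ (Matrix.of fun k l => A (c k) _ _)]
  congr 1
  ext k l
  simp

theorem sum_single_apply_eq_card [Fintype κ] [DecidableEq ι]
    (c : κ → ι) (β : ι) :
    (∑ k, Finsupp.single (c k) 1 : ι →₀ ℕ) β = (Finset.univ.filter fun k => c k = β).card := by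
  simp [Finsupp.finsetSum_apply, Finsupp.single_apply]

theorem exists_perm_comp_eq [Fintype κ] [DecidableEq ι]
    {a c : κ → ι}
    (h : (∑ k, Finsupp.single (c k) 1 : ι →₀ ℕ) = ∑ k, Finsupp.single (a k) 1) :
    ∃ σ : Equiv.Perm κ, a ∘ σ = c := by
  have e : ∀ β, Nonempty ({k // c k = β} ≃ {k // a k = β}) := fun β => by
    refine ⟨Fintype.equivOfCardEq ?_⟩
    rw [Fintype.card_subtype, Fintype.card_subtype, ← sum_single_apply_eq_card, h,
      sum_single_apply_eq_card]
  refine ⟨(Equiv.sigmaFiberEquiv c).symm.trans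
    ((Equiv.sigmaCongrRight fun β => (e β).some).trans (Equiv.sigmaFiberEquiv a)), ?_⟩
  ext k
  exact ((e (c k)).some ⟨k, rfl⟩).2

theorem card_filter_comp_eq [Fintype κ] [DecidableEq κ] [Fintype ι] [DecidableEq ι]
    (a : κ → ι) (σ₀ : Equiv.Perm κ) :
    (Finset.univ.filter fun σ : Equiv.Perm κ => a ∘ σ = a ∘ σ₀).card
      = ∏ β, (Finset.univ.filter fun k => a k = β).card.factorial := by
  simp only [← Fintype.card_subtype, ← DomMulAct.stabilizer_card a]
  refine Fintype.card_congr ((Equiv.mulRight σ₀⁻¹).subtypeEquiv fun σ => ?_)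
  rw [← σ₀.symm.surjective.injective_comp_right.eq_iff]
  simp [Function.comp_assoc, Equiv.Perm.coe_mul]

theorem factorial_mul_eq_prod_factorial_mul_sum [Fintype κ] [DecidableEq κ]
    [Fintype ι] [DecidableEq ι]
    (a : κ → ι) (F : (κ → ι) → R)
    (hF : ∀ σ : Equiv.Perm κ, F (a ∘ σ) = F a) :
    (Fintype.card κ).factorial * F a
      = (∏ β, ((Finset.univ.filter fun k => a k = β).card.factorial : R)) *
        ∑ c : κ → ι with ∑ k, Finsupp.single (c k) 1 =
          (∑ k, Finsupp.single (a k) 1 : ι →₀ ℕ), F c := by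
  have hperm : ∑ σ : Equiv.Perm κ, F (a ∘ σ) = (Fintype.card κ).factorial * F a := by
    simp [hF, Fintype.card_perm]
  rw [← hperm, ← Finset.sum_fiberwise_of_maps_to (g := fun σ : Equiv.Perm κ => a ∘ σ)
    (t := Finset.univ.filter fun c : κ → ι => ∑ k, Finsupp.single (c k) 1 =
          (∑ k, Finsupp.single (a k) 1 : ι →₀ ℕ)), Finset.mul_sum]
  · refine Finset.sum_congr rfl fun c hc => ?_
    obtain ⟨σ₀, rfl⟩ := exists_perm_comp_eq (Finset.mem_filter.1 hc).2
    rw [Finset.sum_eq_card_nsmul (b := F (a ∘ σ₀))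
      fun σ hσ => congrArg F (Finset.mem_filter.1 hσ).2, card_filter_comp_eq, nsmul_eq_mul,
      Nat.cast_prod]
  · intro σ _
    simpa using Equiv.sum_comp σ fun k => (Finsupp.single (a k) 1 : ι →₀ ℕ)

end Minors

theorem sum_gkron_mul_prod {n r : ℕ} (B : Fin r → Matrix (Fin n) (Fin n) ℝ) (i : Fin r → Fin n) :
    ∑ j : Fin r → Fin n, gkron i j * ∏ k, B k (i k) (j k)
      = (Matrix.of fun k l => B k (i k) (i l)).det := by
  have hprod : ∀ (j : Fin r → Fin n) (σ : Equiv.Perm (Fin r)),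
      ∏ k, (if i (σ k) = j k then (1 : ℝ) else 0) = if i ∘ σ = j then 1 else 0 := fun j σ => by
    simp [Finset.prod_ite_zero, funext_iff]
  rw [← Matrix.det_transpose]
  simp only [gkron, Matrix.det_apply', Matrix.of_apply, Matrix.transpose_apply, hprod,
    Finset.sum_mul]
  rw [Finset.sum_comm]
  simp

theorem statement_13 (hq : 1 ≤ q) (A : Fin q → Matrix (Fin p) (Fin p) ℝ) (r : ℕ)
    (as : Fin r → Fin q) :
    sigma A (fun β => (Finset.univ.filter fun k => as k = β).card)
      = (1 / ∏ β, ((((Finset.univ.filter fun k => as k = β).card).factorial : ℝ))) *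
        ∑ i : Fin r → Fin p, ∑ j : Fin r → Fin p,
          gkron i j * ∏ k, A (as k) (i k) (j k) := by
  set u : Fin q →₀ ℕ := ∑ k, Finsupp.single (as k) 1 with hu
  have hσ : sigma A (fun β => (Finset.univ.filter fun k => as k = β).card)
      = MvPolynomial.coeff u (newtonMvPoly A) := by
    unfold sigma
    congr 1
    ext β
    rw [hu, sum_single_apply_eq_card]
    rfl
  have hcoeff := factorial_mul_coeff_det_one_add (κ := Fin r) A u (by simp [hu])
  have hsum := factorial_mul_eq_prod_factorial_mul_sum as
    (fun c => ∑ i : Fin r → Fin p, (Matrix.of fun k l => A (c k) (i k) (i l)).det)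
    (sum_det_comp_perm A as)
  rw [← hu, ← hcoeff, mul_left_comm] at hsum
  have hfact := mul_left_cancel₀ (Nat.cast_ne_zero.2 (Nat.factorial_ne_zero _)) hsum
  have hne : (∏ β, ((Finset.univ.filter fun k => as k = β).card.factorial : ℝ)) ≠ 0 :=
    Finset.prod_ne_zero_iff.2 fun β _ => Nat.cast_ne_zero.2 (Nat.factorial_ne_zero _)
  simp only [sum_gkron_mul_prod (fun k => A (as k))]
  rw [hσ, hfact, one_div, inv_mul_cancel_left₀ hne, newtonMvPoly]

end GNTPaper
end
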